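/- arXiv:quant-ph/9808030 — 2 statements merged into one kernel-verified Lean document; each statement's English description precedes it below -/
import Mathlib

section
/- Let ρ̄ = (1/4)(I − Σ_{j=1}^4 |ψ_j⟩⟨ψ_j|) be the complementary state of the Shifts UPB in ℂ² ⊗ ℂ² ⊗ ℂ². Then ρ̄ is entangled as a tripartite state (it is not a convex combination of projectors onto product vectors a ⊗ b ⊗ c), yet for each of the three bipartite cuts A|(BC), B|(AC), C|(AB) it is separable: it is a convex combination of projectors onto vectors that are product across that cut. -/
/-!
STATEMENT 9. The state ρ̄ = (1/4)(I − Σ_{j=1}^4 |ψ_j⟩⟨ψ_j|) complementary to the Shifts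
UPB is entangled as a tripartite state, yet separable across each of the three bipartite
cuts A|(BC), B|(AC), C|(AB).
-/

open ComplexConjugate

noncomputable section

/-- The standard hermitian inner product on `ι → ℂ` (antilinear in the first slot). -/
def ip {ι : Type*} [Fintype ι] (x y : ι → ℂ) : ℂ := ∑ i, conj (x i) * y i

/-- Tripartite product vector `a ⊗ b ⊗ c` on `Fin 2 × Fin 2 × Fin 2`. -/
def pv3 (a b c : Fin 2 → ℂ) : Fin 2 × Fin 2 × Fin 2 → ℂ :=
  fun p => a p.1 * b p.2.1 * c p.2.2

/-- The outer product `|x⟩⟨x|`. -/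
def outer {ι : Type*} (x : ι → ℂ) : Matrix ι ι ℂ :=
  Matrix.of fun f g => x f * conj (x g)

/-- `|0⟩ ∈ ℂ²`. -/
def q0 : Fin 2 → ℂ := Pi.single 0 1
/-- `|1⟩ ∈ ℂ²`. -/
def q1 : Fin 2 → ℂ := Pi.single 1 1
/-- `|+⟩ = (|0⟩ + |1⟩)/√2`. -/
def qPlus : Fin 2 → ℂ := ((Real.sqrt 2 : ℂ))⁻¹ • (q0 + q1)
/-- `|−⟩ = (|0⟩ − |1⟩)/√2`. -/
def qMinus : Fin 2 → ℂ := ((Real.sqrt 2 : ℂ))⁻¹ • (q0 - q1)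

/-- The Shifts states `|0,1,+⟩, |1,+,0⟩, |+,0,1⟩, |−,−,−⟩`. -/
def shifts : Fin 4 → (Fin 2 × Fin 2 × Fin 2 → ℂ) :=
  ![pv3 q0 q1 qPlus, pv3 q1 qPlus q0, pv3 qPlus q0 q1, pv3 qMinus qMinus qMinus]

/-- The state complementary to the Shifts UPB: `ρ̄ = (1/4)(I − Σ_j |ψ_j⟩⟨ψ_j|)`. -/
def rhoBar : Matrix (Fin 2 × Fin 2 × Fin 2) (Fin 2 × Fin 2 × Fin 2) ℂ :=
  (4 : ℂ)⁻¹ • ((1 : Matrix (Fin 2 × Fin 2 × Fin 2) (Fin 2 × Fin 2 × Fin 2) ℂ)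
    - ∑ j, outer (shifts j))

/-- Full (three-party) separability: a convex combination of projectors onto unit
product vectors `a ⊗ b ⊗ c`. -/
def SepFull (ρ : Matrix (Fin 2 × Fin 2 × Fin 2) (Fin 2 × Fin 2 × Fin 2) ℂ) : Prop :=
  ∃ (k : ℕ) (w : Fin k → ℝ) (a b c : Fin k → Fin 2 → ℂ),
    (∀ t, 0 ≤ w t) ∧ (∑ t, w t) = 1 ∧
    (∀ t, a t ≠ 0 ∧ b t ≠ 0 ∧ c t ≠ 0) ∧
    (∀ t, ip (pv3 (a t) (b t) (c t)) (pv3 (a t) (b t) (c t)) = 1) ∧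
    ρ = ∑ t, (w t : ℂ) • outer (pv3 (a t) (b t) (c t))

/-- Separability across the A|(BC) cut. -/
def SepA (ρ : Matrix (Fin 2 × Fin 2 × Fin 2) (Fin 2 × Fin 2 × Fin 2) ℂ) : Prop :=
  ∃ (k : ℕ) (w : Fin k → ℝ) (u : Fin k → Fin 2 → ℂ) (v : Fin k → Fin 2 × Fin 2 → ℂ),
    (∀ t, 0 ≤ w t) ∧ (∑ t, w t) = 1 ∧
    (∀ t, u t ≠ 0 ∧ v t ≠ 0) ∧
    (∀ t, ip (fun p : Fin 2 × Fin 2 × Fin 2 => u t p.1 * v t p.2)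
             (fun p : Fin 2 × Fin 2 × Fin 2 => u t p.1 * v t p.2) = 1) ∧
    ρ = ∑ t, (w t : ℂ) • outer (fun p : Fin 2 × Fin 2 × Fin 2 => u t p.1 * v t p.2)

/-- Separability across the B|(AC) cut. -/
def SepB (ρ : Matrix (Fin 2 × Fin 2 × Fin 2) (Fin 2 × Fin 2 × Fin 2) ℂ) : Prop :=
  ∃ (k : ℕ) (w : Fin k → ℝ) (u : Fin k → Fin 2 → ℂ) (v : Fin k → Fin 2 × Fin 2 → ℂ),
    (∀ t, 0 ≤ w t) ∧ (∑ t, w t) = 1 ∧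
    (∀ t, u t ≠ 0 ∧ v t ≠ 0) ∧
    (∀ t, ip (fun p : Fin 2 × Fin 2 × Fin 2 => u t p.2.1 * v t (p.1, p.2.2))
             (fun p : Fin 2 × Fin 2 × Fin 2 => u t p.2.1 * v t (p.1, p.2.2)) = 1) ∧
    ρ = ∑ t, (w t : ℂ) • outer (fun p : Fin 2 × Fin 2 × Fin 2 => u t p.2.1 * v t (p.1, p.2.2))

/-- Separability across the C|(AB) cut. -/
def SepC (ρ : Matrix (Fin 2 × Fin 2 × Fin 2) (Fin 2 × Fin 2 × Fin 2) ℂ) : Prop :=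
  ∃ (k : ℕ) (w : Fin k → ℝ) (u : Fin k → Fin 2 → ℂ) (v : Fin k → Fin 2 × Fin 2 → ℂ),
    (∀ t, 0 ≤ w t) ∧ (∑ t, w t) = 1 ∧
    (∀ t, u t ≠ 0 ∧ v t ≠ 0) ∧
    (∀ t, ip (fun p : Fin 2 × Fin 2 × Fin 2 => u t p.2.2 * v t (p.1, p.2.1))
             (fun p : Fin 2 × Fin 2 × Fin 2 => u t p.2.2 * v t (p.1, p.2.1)) = 1) ∧
    ρ = ∑ t, (w t : ℂ) • outer (fun p : Fin 2 × Fin 2 × Fin 2 => u t p.2.2 * v t (p.1, p.2.1))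

theorem ip_pv3 (a b c a' b' c' : Fin 2 → ℂ) :
    ip (pv3 a b c) (pv3 a' b' c') = ip a a' * ip b b' * ip c c' := by
  simp only [ip, pv3, Fintype.sum_prod_type, Fin.sum_univ_two, map_mul]
  ring

theorem ip_fin_two (x y : Fin 2 → ℂ) : ip x y = conj (x 0) * y 0 + conj (x 1) * y 1 :=
  Fin.sum_univ_two _

theorem inv_sqrt_mul_conj (r : ℝ) (hr : 0 ≤ r) :
    ((Real.sqrt r : ℂ))⁻¹ * conj ((Real.sqrt r : ℂ))⁻¹ = (r : ℂ)⁻¹ := by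
  rw [map_inv₀, Complex.conj_ofReal, ← mul_inv, ← Complex.ofReal_mul, Real.mul_self_sqrt hr]

theorem inv_sqrt_two_mul_self : ((Real.sqrt 2 : ℂ))⁻¹ * ((Real.sqrt 2 : ℂ))⁻¹ = 2⁻¹ := by
  simpa using inv_sqrt_mul_conj 2 zero_le_two

theorem outer_smul {ι : Type*} (r : ℂ) (x : ι → ℂ) :
    outer (r • x) = (r * conj r) • outer x := by
  ext i j
  simp only [outer, Matrix.of_apply, Matrix.smul_apply, Pi.smul_apply, smul_eq_mul, map_mul]
  ring

theorem ip_smul_self {ι : Type*} [Fintype ι] (r : ℂ) (x : ι → ℂ) :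
    ip (r • x) (r • x) = r * conj r * ip x x := by
  simp only [ip, Pi.smul_apply, smul_eq_mul, map_mul, Finset.mul_sum]
  exact Finset.sum_congr rfl fun _ _ => by ring

/-- The expectation value `⟨x|M|x⟩`. -/
def expect {ι : Type*} [Fintype ι] (x : ι → ℂ) (M : Matrix ι ι ℂ) : ℂ :=
  ∑ i, ∑ j, conj (x i) * M i j * x j

theorem expect_outer {ι : Type*} [Fintype ι] (x y : ι → ℂ) :
    expect x (outer y) = (Complex.normSq (ip x y) : ℂ) := by
  rw [← Complex.mul_conj]
  simp only [expect, outer, ip, Matrix.of_apply, map_sum, map_mul, Complex.conj_conj,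
    Finset.sum_mul_sum]
  exact Finset.sum_congr rfl fun _ _ => Finset.sum_congr rfl fun _ _ => by ring

theorem expect_one {ι : Type*} [Fintype ι] [DecidableEq ι] (x : ι → ℂ) :
    expect x 1 = ip x x := by
  simp [expect, ip, Matrix.one_apply]

theorem expect_smul {ι : Type*} [Fintype ι] (x : ι → ℂ) (r : ℂ) (M : Matrix ι ι ℂ) :
    expect x (r • M) = r * expect x M := by
  simp only [expect, Matrix.smul_apply, smul_eq_mul, Finset.mul_sum]
  exact Finset.sum_congr rfl fun _ _ => Finset.sum_congr rfl fun _ _ => by ring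

theorem expect_sub {ι : Type*} [Fintype ι] (x : ι → ℂ) (M N : Matrix ι ι ℂ) :
    expect x (M - N) = expect x M - expect x N := by
  simp only [expect, Matrix.sub_apply, mul_sub, sub_mul, Finset.sum_sub_distrib]

theorem expect_sum {ι κ : Type*} [Fintype ι] [Fintype κ] (x : ι → ℂ)
    (M : κ → Matrix ι ι ℂ) : expect x (∑ k, M k) = ∑ k, expect x (M k) := by
  simp only [expect, Matrix.sum_apply, Finset.mul_sum, Finset.sum_mul]
  exact (Finset.sum_congr rfl fun _ _ => Finset.sum_comm).trans Finset.sum_comm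

theorem ip_shifts (j k : Fin 4) : ip (shifts j) (shifts k) = if j = k then 1 else 0 := by
  have h := inv_sqrt_two_mul_self
  fin_cases j <;> fin_cases k <;>
    simp [shifts, ip_pv3, ip_fin_two, q0, q1, qPlus, qMinus, h] <;> norm_num

theorem expect_shifts_rhoBar (j : Fin 4) : expect (shifts j) rhoBar = 0 := by
  rw [rhoBar, expect_smul, expect_sub, expect_one, expect_sum]
  have h (k : Fin 4) : (Complex.normSq (if j = k then 1 else 0) : ℂ) =
      if j = k then 1 else 0 := by
    split_ifs <;> simp
  simp only [expect_outer, ip_shifts, h]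
  simp

/-- No nonzero product vector is orthogonal to all four Shifts states. -/
theorem shifts_unextendible {a b c : Fin 2 → ℂ} (ha : a ≠ 0) (hb : b ≠ 0) (hc : c ≠ 0) :
    ∃ j, ip (shifts j) (pv3 a b c) ≠ 0 := by
  by_contra! h
  have h0 := h 0
  have h1 := h 1
  have h2 := h 2
  have h3 := h 3
  simp only [ne_eq, funext_iff, Fin.forall_fin_two, Pi.zero_apply] at ha hb hc
  simp [shifts, ip_pv3, ip_fin_two, q0, q1, qPlus, qMinus, ← mul_add, ← sub_eq_add_neg, ← mul_sub]
    at h0 h1 h2 h3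
  grind

theorem not_sepFull_rhoBar : ¬ SepFull rhoBar := by
  rintro ⟨k, w, a, b, c, hw, hsum, hne, -, hρ⟩
  obtain ⟨t, ht⟩ : ∃ t, w t ≠ 0 := by
    by_contra! h
    simp [h] at hsum
  obtain ⟨j, hj⟩ := shifts_unextendible (hne t).1 (hne t).2.1 (hne t).2.2
  have h := expect_shifts_rhoBar j
  rw [hρ, expect_sum] at h
  simp only [expect_smul, expect_outer] at h
  norm_cast at h
  rw [Finset.sum_eq_zero_iff_of_nonneg
    fun s _ => mul_nonneg (hw s) (Complex.normSq_nonneg _)] at h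
  have := h t (Finset.mem_univ t)
  simp_all

/-- The complementary state in terms of product vectors with integer entries. -/
theorem rhoBar_eq : rhoBar = (4 : ℂ)⁻¹ • (1 -
    ((2 : ℂ)⁻¹ • outer (pv3 ![1, 0] ![0, 1] ![1, 1]) +
     (2 : ℂ)⁻¹ • outer (pv3 ![0, 1] ![1, 1] ![1, 0]) +
     (2 : ℂ)⁻¹ • outer (pv3 ![1, 1] ![1, 0] ![0, 1]) +
     (8 : ℂ)⁻¹ • outer (pv3 ![1, -1] ![1, -1] ![1, -1]))) := by
  have h := inv_sqrt_mul_conj 2 zero_le_two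
  have e0 : q0 = ![1, 0] := by ext i; fin_cases i <;> simp [q0]
  have e1 : q1 = ![0, 1] := by ext i; fin_cases i <;> simp [q1]
  have ep : qPlus = ((Real.sqrt 2 : ℂ))⁻¹ • ![1, 1] := by simp [qPlus, e0, e1]
  have em : qMinus = ((Real.sqrt 2 : ℂ))⁻¹ • ![1, -1] := by simp [qMinus, e0, e1]
  have s1 (r : ℂ) (a b c : Fin 2 → ℂ) : pv3 (r • a) b c = r • pv3 a b c := by
    ext p; simp [pv3, mul_assoc]
  have s2 (r : ℂ) (a b c : Fin 2 → ℂ) : pv3 a (r • b) c = r • pv3 a b c := by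
    ext p; simp [pv3]; ring
  have s3 (r : ℂ) (a b c : Fin 2 → ℂ) : pv3 a b (r • c) = r • pv3 a b c := by
    ext p; simp [pv3]; ring
  simp only [rhoBar, Fin.sum_univ_four, shifts, ep, em, e0, e1, Matrix.cons_val, s1, s2, s3,
    outer_smul, h]
  norm_num [smul_smul]

set_option maxHeartbeats 2000000 in
theorem sepA_rhoBar : SepA rhoBar := by
  let n : Fin 4 → ℝ := ![6, 6, 6, 24]
  have hn (t : Fin 4) : 0 ≤ n t := by fin_cases t <;> norm_num [n]
  let u : Fin 4 → Fin 2 → ℂ := ![![1, 0], ![0, 1], ![1, 1], ![1, -1]]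
  let z : Fin 4 → Matrix (Fin 2) (Fin 2) ℂ :=
    ![!![2, 0; 1, -1], !![-1, 0; 1, 2], !![1, 0; -1, 1], !![1, 3; -1, 1]]
  have key (t : Fin 4) : (fun p : Fin 2 × Fin 2 × Fin 2 =>
      u t p.1 * ((Real.sqrt (n t) : ℂ)⁻¹ * z t p.2.1 p.2.2)) =
      ((Real.sqrt (n t) : ℂ))⁻¹ • fun p => u t p.1 * z t p.2.1 p.2.2 := by
    ext p
    simp only [Pi.smul_apply, smul_eq_mul]
    ring
  refine ⟨4, fun _ => 4⁻¹, u, fun t p => (Real.sqrt (n t) : ℂ)⁻¹ * z t p.1 p.2,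
    fun _ => by norm_num, by norm_num, fun t => ⟨?_, ?_⟩, fun t => ?_, ?_⟩
  · fin_cases t <;> simp [u]
  · intro h
    have := congrFun h (0, 0)
    fin_cases t <;> simp [z, n] at this
  · rw [key, ip_smul_self, inv_sqrt_mul_conj _ (hn t)]
    fin_cases t <;> simp [ip, Fintype.sum_prod_type, n, u, z, map_ofNat] <;> norm_num
  · simp only [key, outer_smul, inv_sqrt_mul_conj _ (hn _), rhoBar_eq, Fin.sum_univ_four]
    ext ⟨i, j, k⟩ ⟨i', j', k'⟩
    simp only [outer, pv3, Matrix.smul_apply, Matrix.sub_apply, Matrix.add_apply,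
      Matrix.of_apply, Matrix.one_apply, Prod.mk.injEq, smul_eq_mul]
    fin_cases i <;> fin_cases j <;> fin_cases k <;> fin_cases i' <;> fin_cases j' <;>
      fin_cases k' <;> simp [n, u, z, map_ofNat] <;> norm_num

theorem rhoBar_cyclic (a b c a' b' c' : Fin 2) :
    rhoBar (b, c, a) (b', c', a') = rhoBar (a, b, c) (a', b', c') := by
  simp only [rhoBar, Fin.sum_univ_four, shifts, outer, pv3, Matrix.smul_apply,
    Matrix.sub_apply, Matrix.add_apply, Matrix.of_apply, Matrix.one_apply, Prod.mk.injEq,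
    Matrix.cons_val, map_mul, smul_eq_mul,
    show (b = b' ∧ c = c' ∧ a = a') ↔ (a = a' ∧ b = b' ∧ c = c') by tauto]
  ring

theorem ip_comp_equiv {ι κ : Type*} [Fintype ι] [Fintype κ] (e : ι ≃ κ) (x y : κ → ℂ) :
    ip (x ∘ e) (y ∘ e) = ip x y :=
  e.sum_comp fun i => conj (x i) * y i

/-- The cyclic relabelling `(a, b, c) ↦ (b, c, a)` of the three parties. -/
def cyclicEquiv : Fin 2 × Fin 2 × Fin 2 ≃ Fin 2 × Fin 2 × Fin 2 where
  toFun p := (p.2.1, p.2.2, p.1)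
  invFun p := (p.2.2, p.1, p.2.1)

theorem sepB_rhoBar : SepB rhoBar := by
  obtain ⟨k, w, u, v, hw, hsum, hne, hip, hρ⟩ := sepA_rhoBar
  refine ⟨k, w, u, fun t p => v t (p.2, p.1), hw, hsum, fun t => ⟨(hne t).1, fun h => ?_⟩,
    fun t => ?_, ?_⟩
  · exact (hne t).2 (funext fun p => congrFun h (p.2, p.1))
  · rw [← hip t]
    exact ip_comp_equiv cyclicEquiv (fun p => u t p.1 * v t p.2) fun p => u t p.1 * v t p.2
  · ext ⟨a, b, c⟩ ⟨a', b', c'⟩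
    rw [← rhoBar_cyclic, hρ]
    simp [Matrix.sum_apply, outer]

theorem sepC_rhoBar : SepC rhoBar := by
  obtain ⟨k, w, u, v, hw, hsum, hne, hip, hρ⟩ := sepA_rhoBar
  refine ⟨k, w, u, v, hw, hsum, hne, fun t => ?_, ?_⟩
  · rw [← hip t]
    exact ip_comp_equiv cyclicEquiv.symm (fun p => u t p.1 * v t p.2) fun p =>
      u t p.1 * v t p.2
  · ext ⟨a, b, c⟩ ⟨a', b', c'⟩
    rw [rhoBar_cyclic c a b c' a' b', hρ]
    simp [Matrix.sum_apply, outer]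

/-- **The Shifts complementary state is tripartite entangled but separable across every
bipartite cut.** -/
theorem shifts_complement_bound_entangled_but_bipartite_separable :
    ¬ SepFull rhoBar ∧ SepA rhoBar ∧ SepB rhoBar ∧ SepC rhoBar := by
  exact ⟨not_sepFull_rhoBar, sepA_rhoBar, sepB_rhoBar, sepC_rhoBar⟩

end
end

section
/- There is no unextendible product basis in ℂ² ⊗ ℂⁿ for any n ≥ 1: for every finite set of pairwise orthogonal unit product vectors spanning a proper subspace of ℂ² ⊗ ℂⁿ, there exists a nonzero product vector orthogonal to all members of the set. -/
/-!
STATEMENT 13. There is no UPB in ℂ² ⊗ ℂⁿ for any n ≥ 1: every finite set of pairwise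
orthogonal unit product vectors spanning a proper subspace of ℂ² ⊗ ℂⁿ admits a nonzero
product vector orthogonal to all of its members.
-/

open ComplexConjugate

noncomputable section

/-- Bipartite product (Kronecker) vector `a ⊗ b`. -/
def pv2 {ι κ : Type*} (a : ι → ℂ) (b : κ → ℂ) : ι × κ → ℂ := fun p => a p.1 * b p.2

section InnerProduct

variable {ι κ : Type*} [Fintype ι] [Fintype κ]

theorem ip_eq_dotProduct (x y : ι → ℂ) : ip x y = star x ⬝ᵥ y := rfl

theorem ip_conj_symm (x y : ι → ℂ) : conj (ip x y) = ip y x := by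
  simp [ip, map_sum, mul_comm]

theorem ip_eq_zero_symm {x y : ι → ℂ} : ip x y = 0 ↔ ip y x = 0 := by
  rw [← ip_conj_symm x y, map_eq_zero]

theorem ip_self_eq_zero {x : ι → ℂ} : ip x x = 0 ↔ x = 0 := by
  open ComplexOrder in rw [ip_eq_dotProduct, dotProduct_star_self_eq_zero]

theorem ip_pv2 (a x : ι → ℂ) (b y : κ → ℂ) :
    ip (pv2 a b) (pv2 x y) = ip a x * ip b y := by
  simp only [ip, pv2, Fintype.sum_prod_type, Finset.sum_mul_sum, map_mul]
  exact Finset.sum_congr rfl fun i _ => Finset.sum_congr rfl fun j _ => by ring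

/-- Orthogonality to a fixed vector passes to spans. -/
theorem ip_eq_zero_of_mem_span {x : ι → ℂ} {S : Set (ι → ℂ)} (h : ∀ s ∈ S, ip x s = 0)
    {y : ι → ℂ} (hy : y ∈ Submodule.span ℂ S) : ip x y = 0 := by
  induction hy using Submodule.span_induction with
  | mem s hs => exact h s hs
  | zero => simp [ip_eq_dotProduct]
  | add u v _ _ hu hv =>
    rw [ip_eq_dotProduct, dotProduct_add, ← ip_eq_dotProduct, ← ip_eq_dotProduct, hu, hv, add_zero]
  | smul c u _ hu => rw [ip_eq_dotProduct, dotProduct_smul, ← ip_eq_dotProduct, hu, smul_zero]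

/-- A set of vectors with no nonzero vector orthogonal to all of it spans. -/
theorem span_eq_top_of_forall_ip_eq_zero {S : Set (ι → ℂ)}
    (h : ∀ y, (∀ s ∈ S, ip s y = 0) → y = 0) : Submodule.span ℂ S = ⊤ := by
  classical
  by_contra hne
  obtain ⟨f, hf, hle⟩ := Submodule.exists_le_ker_of_lt_top _ (lt_top_iff_ne_top.2 hne)
  have hip (s : ι → ℂ) : ip s (fun i => conj (f (Pi.single i 1))) = conj (f s) := by
    have hsingle (i : ι) : (fun j => if i = j then (1 : ℂ) else 0) = Pi.single i 1 := by
      ext j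
      simp [Pi.single_apply, eq_comm]
    conv_rhs => rw [LinearMap.pi_apply_eq_sum_univ f s]
    simp [ip, hsingle]
  have hy := h _ fun s hs => by
    rw [hip, map_eq_zero]
    exact hle (Submodule.subset_span hs)
  refine hf (LinearMap.ext fun s => ?_)
  have := hip s
  rw [hy, ip_eq_dotProduct, dotProduct_zero, eq_comm, map_eq_zero] at this
  exact this

end InnerProduct

section ProductVectors

variable {ι κ : Type*}

/-- The product vector `a ⊗ b` as a bilinear map. -/
def pv2Bilin (ι κ : Type*) : (ι → ℂ) →ₗ[ℂ] (κ → ℂ) →ₗ[ℂ] (ι × κ → ℂ) :=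
  LinearMap.mk₂ ℂ pv2
    (fun _ _ _ => by ext; simp [pv2, add_mul])
    (fun _ _ _ => by ext; simp [pv2, mul_assoc])
    (fun _ _ _ => by ext; simp [pv2, mul_add])
    (fun _ _ _ => by ext; simp [pv2, mul_left_comm])

theorem pv2Bilin_apply (a : ι → ℂ) (b : κ → ℂ) : pv2Bilin ι κ a b = pv2 a b := rfl

theorem pv2_mem_of_mem_span {W : Submodule ℂ (ι × κ → ℂ)} {x : ι → ℂ} {S : Set (κ → ℂ)}
    (h : ∀ s ∈ S, pv2 x s ∈ W) {y : κ → ℂ} (hy : y ∈ Submodule.span ℂ S) : pv2 x y ∈ W :=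
  (Submodule.span_le (p := W.comap (pv2Bilin ι κ x))).2 h hy

theorem eq_top_of_forall_pv2_mem [Fintype ι] [Fintype κ] {W : Submodule ℂ (ι × κ → ℂ)}
    (h : ∀ x y, pv2 x y ∈ W) : W = ⊤ := by
  classical
  refine eq_top_iff.2 fun v _ => ?_
  rw [pi_eq_sum_univ v]
  refine W.sum_mem fun p _ => W.smul_mem _ ?_
  convert h (Pi.single p.1 1) (Pi.single p.2 1) using 1
  ext q
  simp only [pv2, Pi.single_apply, ← ite_and, mul_ite, mul_one, mul_zero, Prod.ext_iff]
  split_ifs <;> simp_all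

end ProductVectors

section Qubit

/-- A vector of `ℂ²` orthogonal to `c`. -/
def perp (c : Fin 2 → ℂ) : Fin 2 → ℂ := ![-conj (c 1), conj (c 0)]

theorem perp_ne_zero {c : Fin 2 → ℂ} (hc : c ≠ 0) : perp c ≠ 0 := by
  contrapose! hc
  have h0 := congrFun hc 0
  have h1 := congrFun hc 1
  ext i
  fin_cases i <;> simp_all [perp]

theorem ip_perp (c : Fin 2 → ℂ) : ip c (perp c) = 0 := by
  simp [ip, perp]
  ring

theorem ip_fin_two_self_ne_zero {c : Fin 2 → ℂ} (hc : c ≠ 0) :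
    c 0 * conj (c 0) + c 1 * conj (c 1) ≠ 0 := by
  have h : ip c c ≠ 0 := ip_self_eq_zero.not.2 hc
  simpa [ip, mul_comm] using h

theorem exists_eq_smul_add_smul_perp {c : Fin 2 → ℂ} (hc : c ≠ 0) (x : Fin 2 → ℂ) :
    ∃ s t : ℂ, x = s • c + t • perp c := by
  have h := ip_fin_two_self_ne_zero hc
  refine ⟨(conj (c 0) * x 0 + conj (c 1) * x 1) / (c 0 * conj (c 0) + c 1 * conj (c 1)),
    (c 0 * x 1 - c 1 * x 0) / (c 0 * conj (c 0) + c 1 * conj (c 1)), ?_⟩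
  ext i
  fin_cases i
  · simp [perp]
    linear_combination -x 0 * mul_inv_cancel₀ h
  · simp [perp]
    linear_combination -x 1 * mul_inv_cancel₀ h

theorem exists_eq_smul_perp {c x : Fin 2 → ℂ} (hc : c ≠ 0) (h : ip c x = 0) :
    ∃ t : ℂ, x = t • perp c := by
  obtain ⟨s, t, rfl⟩ := exists_eq_smul_add_smul_perp hc x
  rw [ip_eq_dotProduct, dotProduct_add, dotProduct_smul, dotProduct_smul, ← ip_eq_dotProduct,
    ← ip_eq_dotProduct, ip_perp, smul_zero, add_zero, smul_eq_zero] at h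
  refine ⟨t, ?_⟩
  rw [h.resolve_right (ip_self_eq_zero.not.2 hc), zero_smul, zero_add]

end Qubit

/-- If no nonzero product vector is orthogonal to a family of pairwise orthogonal product vectors
in `ℂ² ⊗ ℂⁿ`, then each `b j` lies in the span of those `b l` for which `a l ⊥ a j`. -/
theorem mem_span_of_unextendible {ι κ : Type*} [Fintype κ]
    {a : ι → Fin 2 → ℂ} {b : ι → κ → ℂ} (ha : ∀ j, a j ≠ 0)
    (horth : ∀ j l, j ≠ l → ip (a j) (a l) = 0 ∨ ip (b j) (b l) = 0)
    (hspan : ∀ x ≠ 0, Submodule.span ℂ (b '' {l | ip (a l) x ≠ 0}) = ⊤) (j : ι) :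
    b j ∈ Submodule.span ℂ (b '' {l | ip (a j) (a l) = 0}) := by
  set T : Set ι := {l | ip (a j) (a l) = 0}
  set R : Set ι := {l | ip (a j) (a l) ≠ 0 ∧ ip (a l) (perp (a j)) ≠ 0}
  have hmem : b j ∈ Submodule.span ℂ (b '' T ∪ b '' R) := by
    have htop := hspan _ (perp_ne_zero (ha j))
    refine Submodule.span_mono ?_ (htop ▸ Submodule.mem_top : b j ∈ Submodule.span ℂ _)
    rw [← Set.image_union]
    refine Set.image_mono fun l hl => ?_
    by_cases h : ip (a j) (a l) = 0
    exacts [Or.inl h, Or.inr ⟨h, hl⟩]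
  rw [Submodule.span_union] at hmem
  obtain ⟨u, hu, w, hw, huw⟩ := Submodule.mem_sup.1 hmem
  have hj : ip (b j) w = 0 := by
    refine ip_eq_zero_of_mem_span ?_ hw
    rintro _ ⟨l, hl, rfl⟩
    refine (horth j l ?_).resolve_left hl.1
    rintro rfl
    exact hl.2 (ip_perp _)
  have hT : ∀ l ∈ T, ip (b l) w = 0 := by
    intro l hl
    refine ip_eq_zero_of_mem_span ?_ hw
    rintro _ ⟨m, hm, rfl⟩
    refine (horth l m ?_).resolve_left fun h0 => ?_
    · rintro rfl
      exact hm.1 hl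
    · obtain ⟨t, ht⟩ := exists_eq_smul_perp (ha j) hl
      have ht0 : t ≠ 0 := by
        rintro rfl
        exact ha l (by rw [ht, zero_smul])
      rw [ip_eq_zero_symm, ht, ip_eq_dotProduct, dotProduct_smul, ← ip_eq_dotProduct,
        smul_eq_zero] at h0
      exact hm.2 (h0.resolve_left ht0)
  have hu0 : ip w u = 0 := by
    refine ip_eq_zero_of_mem_span ?_ hu
    rintro _ ⟨l, hl, rfl⟩
    exact ip_eq_zero_symm.1 (hT l hl)
  have hw0 : w = 0 := by
    rw [ip_eq_zero_symm, ← huw, ip_eq_dotProduct, dotProduct_add, ← ip_eq_dotProduct,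
      ← ip_eq_dotProduct, hu0, zero_add] at hj
    exact ip_self_eq_zero.1 hj
  rwa [← huw, hw0, add_zero]

/-- **There is no UPB in ℂ² ⊗ ℂⁿ.** -/
theorem no_upb_in_two_times_n (n : ℕ) (hn : 1 ≤ n) (k : ℕ)
    (a : Fin k → Fin 2 → ℂ) (b : Fin k → Fin n → ℂ)
    (ha : ∀ j, a j ≠ 0) (hb : ∀ j, b j ≠ 0)
    (hunit : ∀ j, ip (pv2 (a j) (b j)) (pv2 (a j) (b j)) = 1)
    (horth : ∀ j l, j ≠ l → ip (pv2 (a j) (b j)) (pv2 (a l) (b l)) = 0)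
    (hproper : Submodule.span ℂ (Set.range fun j => pv2 (a j) (b j)) ≠ ⊤) :
    ∃ (x : Fin 2 → ℂ) (y : Fin n → ℂ), x ≠ 0 ∧ y ≠ 0 ∧
      ∀ j, ip (pv2 (a j) (b j)) (pv2 x y) = 0 := by
  by_contra hext
  push Not at hext
  have horth' : ∀ j l, j ≠ l → ip (a j) (a l) = 0 ∨ ip (b j) (b l) = 0 := fun j l hjl => by
    rw [← mul_eq_zero, ← ip_pv2]
    exact horth j l hjl
  have hspan : ∀ x ≠ 0, Submodule.span ℂ (b '' {l | ip (a l) x ≠ 0}) = ⊤ := by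
    refine fun x hx => span_eq_top_of_forall_ip_eq_zero fun y hy => ?_
    by_contra hy0
    obtain ⟨l, hl⟩ := hext x y hx hy0
    rw [ip_pv2] at hl
    exact right_ne_zero_of_mul hl (hy _ ⟨l, left_ne_zero_of_mul hl, rfl⟩)
  set W := Submodule.span ℂ (Set.range fun j => pv2 (a j) (b j))
  have hW (j) : pv2 (a j) (b j) ∈ W := Submodule.subset_span ⟨j, rfl⟩
  have hperp (j) : pv2 (perp (a j)) (b j) ∈ W := by
    refine pv2_mem_of_mem_span ?_ (mem_span_of_unextendible ha horth' hspan j)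
    rintro _ ⟨l, hl, rfl⟩
    obtain ⟨t, ht⟩ := exists_eq_smul_perp (ha j) hl
    have ht0 : t ≠ 0 := by
      rintro rfl
      exact ha l (by rw [ht, zero_smul])
    have h := hW l
    rw [ht, ← pv2Bilin_apply, map_smul, LinearMap.smul_apply] at h
    exact (W.smul_mem_iff ht0).1 h
  have hall (x) (j) : pv2 x (b j) ∈ W := by
    obtain ⟨s, t, rfl⟩ := exists_eq_smul_add_smul_perp (ha j) x
    rw [← pv2Bilin_apply, map_add, map_smul, map_smul]
    exact W.add_mem (W.smul_mem _ (hW j)) (W.smul_mem _ (hperp j))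
  refine hproper (eq_top_of_forall_pv2_mem fun x y => ?_)
  have htop := hspan 1 one_ne_zero
  refine pv2_mem_of_mem_span ?_ (htop ▸ Submodule.mem_top : y ∈ Submodule.span ℂ _)
  rintro _ ⟨l, -, rfl⟩
  exact hall x l

end
end
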